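/- Let α₁, …, α_s be pairwise distinct real algebraic numbers, and for k = 1, …, s let a_1^k, …, a_n^k and b^k be real algebraic numbers. Then for every integer vector x ∈ ℤ^n, the single equation ∑_{k=1}^{s} e^{α_k} ( ∑_{j=1}^{n} a_j^k x_j + b^k ) = 0 holds if and only if ∑_{j=1}^{n} a_j^k x_j + b^k = 0 for every k = 1, …, s. -/

import Mathlib

open Polynomial

/-- Finitely many nonzero algebraic numbers are roots of one integer polynomial that does not
vanish at `0`. -/
theorem exists_int_polynomial_eval_zero_ne_zero {K : Type*} [Field K] (S : Finset K)
    (hS : ∀ a ∈ S, IsAlgebraic ℤ a) (h0 : (0 : K) ∉ S) :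
    ∃ f : ℤ[X], f.eval 0 ≠ 0 ∧ ∀ a ∈ S, aeval a f = 0 := by
  classical
  induction S using Finset.induction_on with
  | empty => exact ⟨1, by simp, by simp⟩
  | insert a S _ ih =>
    obtain ⟨f, hf, hfS⟩ := ih (fun b hb => hS b (Finset.mem_insert_of_mem hb))
      (fun h => h0 (Finset.mem_insert_of_mem h))
    have ha : a ≠ 0 := fun h => h0 (h ▸ Finset.mem_insert_self a S)
    obtain ⟨g, hg, hga⟩ := (hS a (Finset.mem_insert_self a S)).exists_nonzero_coeff_and_aeval_eq_zero
      (mem_nonZeroDivisors_of_ne_zero ha)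
    refine ⟨g * f, ?_, fun b hb => ?_⟩
    · rw [eval_mul, ← coeff_zero_eq_eval_zero]
      exact mul_ne_zero hg hf
    · rcases Finset.mem_insert.mp hb with rfl | hb
      · simp [hga]
      · simp [hfS b hb]

theorem isIntegral_pow_mul_aeval {K : Type*} [Field K] {m a : K} (hm : IsIntegral ℤ m)
    (hma : IsIntegral ℤ (m * a)) (g : ℤ[X]) {N : ℕ} (hN : g.natDegree ≤ N) :
    IsIntegral ℤ (m ^ N * aeval a g) := by
  rw [aeval_eq_sum_range' (Nat.lt_succ_of_le hN), Finset.mul_sum]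
  refine IsIntegral.sum _ fun i hi => ?_
  have hi' : i ≤ N := Nat.lt_succ_iff.mp (Finset.mem_range.mp hi)
  have : m ^ N * g.coeff i • a ^ i = g.coeff i • (m ^ (N - i) * (m * a) ^ i) := by
    rw [mul_smul_comm, mul_pow, ← mul_assoc, ← pow_add, Nat.sub_add_cancel hi']
  rw [this]
  exact ((hm.pow _).mul (hma.pow _)).smul _

theorem exists_int_eq_of_isIntegral_of_forall_fixed {K : Type*} [Field K] [Algebra ℚ K]
    [FiniteDimensional ℚ K] [IsGalois ℚ K] {x : K} (hx : IsIntegral ℤ x)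
    (hfix : ∀ σ : K ≃ₐ[ℚ] K, σ x = x) : ∃ z : ℤ, x = z := by
  obtain ⟨q, rfl⟩ := (IsGalois.mem_range_algebraMap_iff_fixed x).mpr hfix
  obtain ⟨z, rfl⟩ := IsIntegrallyClosed.algebraMap_eq_of_integral
    ((isIntegral_algebraMap_iff (algebraMap ℚ K).injective).mp hx)
  exact ⟨z, by simp⟩

theorem exists_nat_forall_isIntegral_mul {K : Type*} [Field K] [CharZero K] (S : Finset K)
    (hS : ∀ a ∈ S, IsAlgebraic ℤ a) : ∃ m : ℕ, m ≠ 0 ∧ ∀ a ∈ S, IsIntegral ℤ ((m : K) * a) := by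
  classical
  induction S using Finset.induction_on with
  | empty => exact ⟨1, by simp, by simp⟩
  | insert a S _ ih =>
    obtain ⟨m, hm, hmS⟩ := ih (fun b hb => hS b (Finset.mem_insert_of_mem hb))
    obtain ⟨k, hk, hka⟩ := (hS a (Finset.mem_insert_self a S)).exists_integral_multiple
    have hka' : IsIntegral ℤ ((k.natAbs : K) * a) := by
      rcases Int.natAbs_eq k with h | h <;> rw [h] at hka
      · simpa using hka
      · simpa using hka.neg
    refine ⟨k.natAbs * m, mul_ne_zero (by simpa using hk) hm, fun b hb => ?_⟩
    rcases Finset.mem_insert.mp hb with rfl | hb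
    · rw [Nat.cast_mul, mul_comm (k.natAbs : K), mul_assoc]
      exact (isIntegral_natCast m).mul hka'
    · rw [Nat.cast_mul, mul_assoc]
      exact (isIntegral_natCast _).mul (hmS b hb)

theorem eventually_mul_pow_div_factorial_pred_lt_one (B c : ℝ) :
    ∀ᶠ p : ℕ in Filter.atTop, B * (c ^ p / (p - 1).factorial) < 1 := by
  have h := ((FloorSemiring.tendsto_pow_div_factorial_atTop c).const_mul (B * c)).comp
    (Filter.tendsto_sub_atTop_nat 1)
  rw [mul_zero] at h
  filter_upwards [h.eventually_lt_const one_pos, Filter.eventually_ge_atTop 1] with p hp h1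
  refine lt_of_eq_of_lt ?_ hp
  obtain ⟨k, rfl⟩ := Nat.exists_eq_add_of_le' h1
  simp [pow_succ]
  ring

/-- A Galois-invariant integral combination of exponentials of nonzero algebraic numbers is never
a nonzero integer. -/
theorem int_add_sum_exp_ne_zero {K : Type*} [Field K] [CharZero K] [Algebra ℚ K]
    [FiniteDimensional ℚ K] [IsGalois ℚ K] [Algebra K ℂ] (S : Finset K) (h0 : (0 : K) ∉ S)
    (hS : ∀ (σ : K ≃ₐ[ℚ] K) (a : K), σ a ∈ S ↔ a ∈ S) (c : K → ℤ)
    (hc : ∀ (σ : K ≃ₐ[ℚ] K) (a : K), c (σ a) = c a) (k : ℤ) (hk : k ≠ 0) :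
    (k : ℂ) + ∑ a ∈ S, (c a : ℂ) * Complex.exp (algebraMap K ℂ a) ≠ 0 := by
  intro hsum
  have halg : ∀ a ∈ S, IsAlgebraic ℤ a := fun a _ =>
    (IsFractionRing.isAlgebraic_iff ℤ ℚ K).mpr (Algebra.IsAlgebraic.isAlgebraic a)
  obtain ⟨f, hf0, hfS⟩ := exists_int_polynomial_eval_zero_ne_zero S halg h0
  obtain ⟨m, hm, hmS⟩ := exists_nat_forall_isIntegral_mul S halg
  obtain ⟨C, hC⟩ := LindemannWeierstrass.exp_polynomial_approx f hf0
  have hf : f ≠ 0 := by rintro rfl; simp at hf0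
  set d := f.natDegree
  set B : ℝ := ∑ a ∈ S, |(c a : ℝ)|
  obtain ⟨P, hP⟩ := Filter.eventually_atTop.mp
    (eventually_mul_pow_div_factorial_pred_lt_one B ((m : ℝ) ^ d * C))
  obtain ⟨p, hpge, hp⟩ := Nat.exists_infinite_primes (P + (f.eval 0).natAbs + m + k.natAbs + 1)
  obtain ⟨n, hpn, g, hg, happ⟩ := hC p (by omega) hp
  have hlt := hP p (by omega)
  have hgdeg : g.natDegree ≤ p * d := hg.trans (Nat.sub_le _ _)
  obtain ⟨z, hz⟩ : ∃ z : ℤ, ∑ a ∈ S, (c a : K) * ((m : K) ^ (p * d) * aeval a g) = z := by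
    apply exists_int_eq_of_isIntegral_of_forall_fixed
    · refine IsIntegral.sum _ fun a ha => (isIntegral_intCast _).mul ?_
      exact isIntegral_pow_mul_aeval (isIntegral_natCast m) (hmS a ha) g hgdeg
    · intro σ
      rw [map_sum]
      refine Finset.sum_equiv σ.toEquiv (fun a => (hS σ a).symm) fun a _ => ?_
      have : σ (aeval a g) = aeval (σ a) g := by
        simpa using (aeval_algHom_apply (σ.toAlgHom.restrictScalars ℤ) a g).symm
      simp [this, hc]
  have hzC : ∑ a ∈ S, (c a : ℂ) * ((m : ℂ) ^ (p * d) * aeval (algebraMap K ℂ a) g) = z := by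
    have := congrArg (algebraMap K ℂ) hz
    simpa [map_sum, aeval_algebraMap_apply] using this
  have key : ((m ^ (p * d) * n * k + p * z : ℤ) : ℂ) =
      -((m : ℂ) ^ (p * d) * ∑ a ∈ S, (c a : ℂ) *
        (n • Complex.exp (algebraMap K ℂ a) - p • aeval (algebraMap K ℂ a) g)) := by
    have hk' : (k : ℂ) = -∑ a ∈ S, (c a : ℂ) * Complex.exp (algebraMap K ℂ a) :=
      eq_neg_of_add_eq_zero_left hsum
    push_cast
    rw [hk', ← hzC, ← sub_eq_zero]
    simp only [mul_neg, zsmul_eq_mul, nsmul_eq_mul, Finset.mul_sum, ← Finset.sum_sub_distrib,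
      ← Finset.sum_neg_distrib, ← Finset.sum_add_distrib]
    exact Finset.sum_eq_zero fun a _ => by ring
  have hbound : ‖((m ^ (p * d) * n * k + p * z : ℤ) : ℂ)‖ < 1 := by
    rw [key, norm_neg, norm_mul]
    calc _ ≤ (m : ℝ) ^ (p * d) * ∑ a ∈ S, |(c a : ℝ)| * (C ^ p / (p - 1).factorial) := by
          rw [norm_pow, Complex.norm_natCast]
          gcongr
          refine (norm_sum_le _ _).trans (Finset.sum_le_sum fun a ha => ?_)
          rw [norm_mul, Complex.norm_intCast]
          gcongr
          refine happ ((mem_aroots).mpr ⟨hf, ?_⟩)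
          rw [aeval_algebraMap_apply, hfS a ha, map_zero]
      _ = B * (((m : ℝ) ^ d * C) ^ p / (p - 1).factorial) := by
          rw [← Finset.sum_mul, mul_pow, ← pow_mul, mul_comm d p]
          ring
      _ < 1 := hlt
  rw [Complex.norm_intCast] at hbound
  have hzero : (m : ℤ) ^ (p * d) * n * k + p * z = 0 := by
    apply Int.abs_lt_one_iff.mp
    exact_mod_cast hbound
  have hpZ : Prime (p : ℤ) := Nat.prime_iff_prime_int.mp hp
  have hdvd : (p : ℤ) ∣ (m : ℤ) ^ (p * d) * n * k :=
    (Int.dvd_add_left (dvd_mul_right _ z)).mp (hzero ▸ dvd_zero _)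
  rcases hpZ.dvd_or_dvd hdvd with h | h
  · rcases hpZ.dvd_or_dvd h with h | h
    · have := Nat.le_of_dvd (Nat.pos_of_ne_zero hm)
        (Int.natCast_dvd_natCast.mp (hpZ.dvd_of_dvd_pow h))
      omega
    · exact hpn h
  · have := Nat.le_of_dvd (Int.natAbs_pos.mpr hk) (Int.natCast_dvd.mp h)
    omega

/-- The evaluation of formal combinations of elements of `K` at the exponential function. -/
noncomputable def expEval (R K : Type*) [Field K] [Algebra K ℂ] [CommSemiring R] [Algebra R ℂ] :
    AddMonoidAlgebra R K →ₐ[R] ℂ :=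
  AddMonoidAlgebra.lift R ℂ K
    { toFun := fun a => Complex.exp (algebraMap K ℂ a.toAdd)
      map_one' := by simp
      map_mul' := fun a b => by simp [Complex.exp_add] }

theorem expEval_apply {R K : Type*} [Field K] [Algebra K ℂ] [CommSemiring R] [Algebra R ℂ]
    (x : AddMonoidAlgebra R K) :
    expEval R K x = x.coeff.sum fun a r => r • Complex.exp (algebraMap K ℂ a) := by
  rw [expEval, AddMonoidAlgebra.lift_apply]
  rfl

/-- A nonzero element of the kernel of a ring homomorphism can be made invariant under the action
of a finite group. -/
theorem exists_ne_zero_map_eq_zero_forall_smul_eq {A B G : Type*} [CommRing A] [IsDomain A]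
    [CommSemiring B] [Group G] [Finite G] [MulSemiringAction G A] (E : A →+* B) {x : A}
    (hx : x ≠ 0) (hE : E x = 0) : ∃ y : A, y ≠ 0 ∧ E y = 0 ∧ ∀ g : G, g • y = y := by
  classical
  have := Fintype.ofFinite G
  refine ⟨∏ g : G, g • x, Finset.prod_ne_zero_iff.mpr fun g _ => (smul_ne_zero_iff_ne g).mpr hx, ?_,
    fun g => ?_⟩
  · rw [map_prod]
    exact Finset.prod_eq_zero (Finset.mem_univ 1) (by rwa [one_smul])
  · rw [Finset.smul_prod']
    simp_rw [smul_smul]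
    exact (Group.mulLeft_bijective g).prod_comp fun h => h • x

section Galois

variable {K : Type*} [Field K] [CharZero K] [Algebra ℚ K] [FiniteDimensional ℚ K]
  [Algebra K ℂ]

theorem exists_rat_expEval_eq_zero [IsGalois ℚ K] {x : AddMonoidAlgebra K K} (hx : x ≠ 0)
    (hE : expEval K K x = 0) : ∃ y : AddMonoidAlgebra ℚ K, y ≠ 0 ∧ expEval ℚ K y = 0 := by
  let act : MulSemiringAction (K ≃ₐ[ℚ] K) (AddMonoidAlgebra K K) :=
    { smul := fun σ y => y.map (σ : K →+ K)
      one_smul := fun y => AddMonoidAlgebra.map_id y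
      mul_smul := fun σ τ y => (AddMonoidAlgebra.map_map (σ : K →+ K) (τ : K →+ K) y).symm
      smul_zero := fun σ => AddMonoidAlgebra.map_zero _
      smul_add := fun σ => AddMonoidAlgebra.map_add _
      smul_one := fun σ => AddMonoidAlgebra.map_one (σ : K →+* K)
      smul_mul := fun σ => AddMonoidAlgebra.map_mul (σ : K →+* K) }
  obtain ⟨y, hy, hyE, hfix⟩ := exists_ne_zero_map_eq_zero_forall_smul_eq (G := K ≃ₐ[ℚ] K)
    (expEval K K).toRingHom hx hE
  have hr : y ∈ Set.range (AddMonoidAlgebra.map (M := K) (algebraMap ℚ K : ℚ →+ K)) := by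
    rw [AddMonoidAlgebra.range_map]
    intro a
    refine (IsGalois.mem_range_algebraMap_iff_fixed _).mpr fun σ => ?_
    conv_rhs => rw [← hfix σ]
    rfl
  obtain ⟨z, rfl⟩ := hr
  refine ⟨z, ?_, ?_⟩
  · rintro rfl
    exact hy (AddMonoidAlgebra.map_zero _)
  · rw [expEval, ← AddMonoidAlgebra.lift_mapRingHom_algebraMap (S := K)]
    exact hyE

theorem exists_invariant_expEval_eq_zero {x : AddMonoidAlgebra ℚ K} (hx : x ≠ 0)
    (hE : expEval ℚ K x = 0) : ∃ y : AddMonoidAlgebra ℚ K, y.coeff 0 ≠ 0 ∧ expEval ℚ K y = 0 ∧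
      ∀ (σ : K ≃ₐ[ℚ] K) (a : K), y.coeff (σ a) = y.coeff a := by
  classical
  let act : MulSemiringAction (K ≃ₐ[ℚ] K) (AddMonoidAlgebra ℚ K) :=
    { smul := fun σ y => y.mapDomain σ
      one_smul := fun y => AddMonoidAlgebra.ext (Finsupp.mapDomain_id)
      mul_smul := fun σ τ y => AddMonoidAlgebra.ext
        (Finsupp.mapDomain_comp (f := τ) (g := σ))
      smul_zero := fun σ => AddMonoidAlgebra.mapDomain_zero _
      smul_add := fun σ => AddMonoidAlgebra.mapDomain_add _
      smul_one := fun σ => AddMonoidAlgebra.mapDomain_one σ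
      smul_mul := fun σ => AddMonoidAlgebra.mapDomain_mul σ }
  have hact (σ : K ≃ₐ[ℚ] K) (y : AddMonoidAlgebra ℚ K) (a : K) :
      (σ • y).coeff (σ a) = y.coeff a :=
    Finsupp.mapDomain_apply σ.injective y.coeff a
  have hsingle (σ : K ≃ₐ[ℚ] K) (a : K) (r : ℚ) :
      σ • AddMonoidAlgebra.single a r = AddMonoidAlgebra.single (σ a) r :=
    AddMonoidAlgebra.mapDomain_single
  obtain ⟨y, hy, hyE, hfix⟩ := exists_ne_zero_map_eq_zero_forall_smul_eq (G := K ≃ₐ[ℚ] K)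
    (expEval ℚ K).toRingHom hx hE
  have hinv {y : AddMonoidAlgebra ℚ K} (h : ∀ σ : K ≃ₐ[ℚ] K, σ • y = y) (σ : K ≃ₐ[ℚ] K) (a : K) :
      y.coeff (σ a) = y.coeff a := by
    conv_lhs => rw [← h σ]
    exact hact σ y a
  obtain ⟨a, ha⟩ : ∃ a, y.coeff a ≠ 0 := by
    by_contra! h
    exact hy (AddMonoidAlgebra.ext (Finsupp.ext h))
  refine ⟨y * ∑ σ : K ≃ₐ[ℚ] K, AddMonoidAlgebra.single (σ (-a)) 1, ?_, ?_, hinv fun σ => ?_⟩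
  · simp [Finset.mul_sum, AddMonoidAlgebra.coeff_sum, Finsupp.finsetSum_apply,
      AddMonoidAlgebra.coeff_mul_single_apply, hinv hfix, ha]
  · rw [map_mul, show expEval ℚ K y = 0 from hyE, zero_mul]
  · rw [smul_mul', hfix, Finset.smul_sum]
    simp_rw [hsingle]
    congr 1
    exact (Group.mulLeft_bijective σ).sum_comp
      fun τ : K ≃ₐ[ℚ] K => AddMonoidAlgebra.single (τ (-a)) (1 : ℚ)

theorem expEval_injective [IsGalois ℚ K] : Function.Injective (expEval K K) := by
  classical
  rw [injective_iff_map_eq_zero]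
  intro x hE
  by_contra hx
  obtain ⟨y, hy, hyE⟩ := exists_rat_expEval_eq_zero hx hE
  obtain ⟨w, hw0, hwE, hw⟩ := exists_invariant_expEval_eq_zero hy hyE
  obtain ⟨b, hb⟩ := IsLocalization.exist_integer_multiples_of_finset (nonZeroDivisors ℤ)
    (w.coeff.support.image w.coeff)
  have hb' (a : K) : ∃ z : ℤ, (z : ℚ) = (b : ℤ) * w.coeff a := by
    by_cases ha : w.coeff a = 0
    · exact ⟨0, by simp [ha]⟩
    · obtain ⟨z, hz⟩ := hb (w.coeff a)
        (Finset.mem_image_of_mem _ (Finsupp.mem_support_iff.mpr ha))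
      exact ⟨z, by simpa [Submonoid.smul_def] using hz⟩
  choose c hc using hb'
  have hb0 : (b : ℤ) ≠ 0 := nonZeroDivisors.coe_ne_zero b
  have hcC (a : K) : (c a : ℂ) = (b : ℤ) * (w.coeff a : ℂ) := by
    exact_mod_cast congrArg (Rat.cast : ℚ → ℂ) (hc a)
  refine int_add_sum_exp_ne_zero (w.coeff.support.erase 0) (Finset.notMem_erase _ _)
    (fun σ a => by simp [hw]) c (fun σ a => ?_) (c 0) (fun h => ?_) ?_
  · have := hc (σ a)
    rw [hw, ← hc a] at this
    exact_mod_cast this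
  · have := hc 0
    simp [h, hb0, hw0] at this
  · have h0 : (0 : K) ∈ w.coeff.support := Finsupp.mem_support_iff.mpr hw0
    have := Finset.add_sum_erase _
      (fun a => (c a : ℂ) * Complex.exp (algebraMap K ℂ a)) h0
    simp only [map_zero, Complex.exp_zero, mul_one] at this
    rw [this]
    rw [expEval_apply, Finsupp.sum] at hwE
    simp_rw [hcC, mul_assoc, ← Finset.mul_sum]
    simp only [Rat.smul_def] at hwE
    rw [hwE, mul_zero]

end Galois

theorem exists_isGalois_intermediateField (S : Finset ℂ) (hS : ∀ a ∈ S, IsAlgebraic ℚ a) :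
    ∃ K : IntermediateField ℚ ℂ, FiniteDimensional ℚ K ∧ IsGalois ℚ K ∧ ∀ a ∈ S, a ∈ K := by
  set p : ℚ[X] := ∏ a ∈ S, minpoly ℚ a
  have hp : p ≠ 0 := Finset.prod_ne_zero_iff.mpr fun a ha => minpoly.ne_zero (hS a ha).isIntegral
  have : p.IsSplittingField ℚ (IntermediateField.adjoin ℚ (p.rootSet ℂ)) :=
    IntermediateField.adjoin_rootSet_isSplittingField (IsAlgClosed.splits _)
  have hfd := IsSplittingField.finiteDimensional (IntermediateField.adjoin ℚ (p.rootSet ℂ)) p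
  have := Normal.of_isSplittingField (E := IntermediateField.adjoin ℚ (p.rootSet ℂ)) p
  refine ⟨_, hfd, ⟨⟩, fun a ha => IntermediateField.subset_adjoin _ _ ?_⟩
  rw [mem_rootSet]
  refine ⟨hp, ?_⟩
  rw [map_prod]
  exact Finset.prod_eq_zero ha (minpoly.aeval ℚ a)

/-- The **Lindemann–Weierstrass theorem**: exponentials of distinct algebraic numbers are linearly
independent over the algebraic numbers. -/
theorem eq_zero_of_sum_mul_exp_eq_zero {ι : Type*} [Fintype ι] {α β : ι → ℂ}
    (hα : ∀ i, IsAlgebraic ℚ (α i)) (hβ : ∀ i, IsAlgebraic ℚ (β i)) (hinj : Function.Injective α)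
    (h : ∑ i, β i * Complex.exp (α i) = 0) (i : ι) : β i = 0 := by
  classical
  obtain ⟨K, _, _, hK⟩ := exists_isGalois_intermediateField
    (Finset.univ.image α ∪ Finset.univ.image β) (by
      simp only [Finset.mem_union, Finset.mem_image, Finset.mem_univ, true_and]
      rintro _ (⟨i, rfl⟩ | ⟨i, rfl⟩)
      exacts [hα i, hβ i])
  have hαK (i : ι) : α i ∈ K := hK _ (by simp)
  have hβK (i : ι) : β i ∈ K := hK _ (by simp)
  have hx : (∑ i, AddMonoidAlgebra.single (⟨α i, hαK i⟩ : K) (⟨β i, hβK i⟩ : K)) = 0 := by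
    apply expEval_injective
    rw [map_zero, map_sum, ← h]
    refine Finset.sum_congr rfl fun i _ => ?_
    simp [expEval_apply, Algebra.smul_def]
  have := congrArg (fun y => AddMonoidAlgebra.coeff y ⟨α i, hαK i⟩) hx
  simp only [AddMonoidAlgebra.coeff_sum, Finsupp.finsetSum_apply, AddMonoidAlgebra.coeff_single,
    Finsupp.single_apply, Subtype.mk.injEq, hinj.eq_iff, AddMonoidAlgebra.coeff_zero,
    Finsupp.zero_apply, Finset.sum_ite_eq', Finset.mem_univ, if_true] at this
  exact congrArg Subtype.val this


/-- For pairwise distinct real algebraic numbers `α 1, …, α s` and real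
algebraic coefficients `a j k`, `b k`, an integer point `x` satisfies the
single equation `∑ k, e^{α k} (∑ j, a k j * x j + b k) = 0` if and only if it
satisfies `∑ j, a k j * x j + b k = 0` for every `k`. -/
theorem exp_combination_vanishes_iff_each_vanishes
    (s n : ℕ) (α : Fin s → ℝ)
    (halg : ∀ k, IsAlgebraic ℚ (α k))
    (hdist : Function.Injective α)
    (a : Fin s → Fin n → ℝ) (b : Fin s → ℝ)
    (ha : ∀ k j, IsAlgebraic ℚ (a k j))
    (hb : ∀ k, IsAlgebraic ℚ (b k)) :
    ∀ x : Fin n → ℤ,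
      ((∑ k, Real.exp (α k) * ((∑ j, a k j * (x j : ℝ)) + b k)) = 0 ↔
        ∀ k, (∑ j, a k j * (x j : ℝ)) + b k = 0) := by
  intro x
  refine ⟨fun h k => ?_, fun h => Finset.sum_eq_zero fun k _ => by rw [h k, mul_zero]⟩
  have hcoeff (k : Fin s) : IsAlgebraic ℚ ((∑ j, a k j * (x j : ℝ)) + b k) := by
    refine IsAlgebraic.add ?_ (hb k)
    exact (Subalgebra.algebraicClosure ℚ ℝ).sum_mem fun j _ =>
      (ha k j).mul (isAlgebraic_intCast (x j))
  have hinj : Function.Injective fun k => (α k : ℂ) := Complex.ofReal_injective.comp hdist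
  have hsum : ∑ k, (((∑ j, a k j * (x j : ℝ)) + b k : ℝ) : ℂ) * Complex.exp (α k : ℂ) = 0 := by
    rw [← Complex.ofReal_zero, ← h, Complex.ofReal_sum]
    exact Finset.sum_congr rfl fun k _ => by rw [Complex.ofReal_mul, Complex.ofReal_exp, mul_comm]
  exact Complex.ofReal_eq_zero.mp <| eq_zero_of_sum_mul_exp_eq_zero
    (fun k => (halg k).algebraMap (A := ℂ)) (fun k => (hcoeff k).algebraMap (A := ℂ)) hinj hsum k
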